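/- Let N ≥ 2, let z ≠ 0 and ω be real constants, let b_1,…,b_N be real parameters, and work on the open subset of ℝ^{2N} where every q_i ≠ 0. With K_i^{(N)} = −Σ_{k=1}^{i−1} q_k² + Σ_{l=i+1}^{N} q_l², define J_- = Σ_i q_i², J_+ = Σ_i ((sinh(z q_i²)/(z q_i²)) p_i² + z b_i/sinh(z q_i²)) e^{z K_i^{(N)}}, the deformed Smorodinsky–Winternitz Hamiltonian H_z^{MS,SW} = ½ J_+ e^{z J_-} + ω (sinh(z J_-)/z) e^{z J_-}, and the function I_z = (sinh(z q_1²)/(2 z q_1²)) e^{z q_1²} p_1² + (z b_1/(2 sinh(z q_1²))) e^{z q_1²} + (ω/(2z)) e^{2 z q_1²}. Then {I_z, H_z^{MS,SW}} = 0 with respect to the canonical Poisson bracket. -/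

import Mathlib

open scoped BigOperators
open Real

noncomputable section

/-- Phase space ℝ^{2N} with canonical coordinates (q, p). -/
abbrev Phase (N : ℕ) : Type := (Fin N → ℝ) × (Fin N → ℝ)

/-- The canonical Poisson bracket
`{f,g} = ∑ i, (∂f/∂q_i · ∂g/∂p_i − ∂g/∂q_i · ∂f/∂p_i)`. -/
noncomputable def pb {N : ℕ} (f g : Phase N → ℝ) (x : Phase N) : ℝ :=
  ∑ i : Fin N,
    ((fderiv ℝ f x) (Pi.single i 1, 0) * (fderiv ℝ g x) (0, Pi.single i 1)
      - (fderiv ℝ g x) (Pi.single i 1, 0) * (fderiv ℝ f x) (0, Pi.single i 1))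

/-- `K_i^{(h)} = −Σ_{k=1}^{i−1} q_k² + Σ_{l=i+1}^{h} q_l²` (paper's 1-indexed
ranges; here indices are 0-indexed, so the second sum runs over `i < l < h`). -/
noncomputable def Kf (N : ℕ) (h : ℕ) (i : Fin N) (q : Fin N → ℝ) : ℝ :=
  ∑ k : Fin N, if (k : ℕ) < (i : ℕ) then -(q k) ^ 2
    else if (i : ℕ) < (k : ℕ) ∧ (k : ℕ) < h then (q k) ^ 2 else 0

/-- `K̃_i^{(h)} = −Σ_{k=h}^{i−1} q_k² + Σ_{l=i+1}^{N} q_l²` (paper's 1-indexed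
lower bound `h`; here `t = h − 1` is the 0-indexed lower bound). -/
noncomputable def Kt (N : ℕ) (t : ℕ) (i : Fin N) (q : Fin N → ℝ) : ℝ :=
  ∑ k : Fin N, if t ≤ (k : ℕ) ∧ (k : ℕ) < (i : ℕ) then -(q k) ^ 2
    else if (i : ℕ) < (k : ℕ) then (q k) ^ 2 else 0

/-- The deformed `J_-^{(N)} = Σ q_i²`. -/
noncomputable def Jmz (N : ℕ) : Phase N → ℝ := fun x => ∑ i : Fin N, (x.1 i) ^ 2

/-- The deformed
`J_+^{(N)} = Σ_i ((sinh(z q_i²)/(z q_i²)) p_i² + z b_i/sinh(z q_i²)) e^{z K_i^{(N)}}`. -/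
noncomputable def Jpz (N : ℕ) (z : ℝ) (b : Fin N → ℝ) : Phase N → ℝ :=
  fun x => ∑ i : Fin N,
    (Real.sinh (z * (x.1 i) ^ 2) / (z * (x.1 i) ^ 2) * (x.2 i) ^ 2
        + z * b i / Real.sinh (z * (x.1 i) ^ 2))
      * Real.exp (z * Kf N N i x.1)

/-- The deformed `J_3^{(N)} = Σ_i (sinh(z q_i²)/(z q_i²)) q_i p_i e^{z K_i^{(N)}}`. -/
noncomputable def J3z (N : ℕ) (z : ℝ) : Phase N → ℝ :=
  fun x => ∑ i : Fin N,
    Real.sinh (z * (x.1 i) ^ 2) / (z * (x.1 i) ^ 2) * (x.1 i * x.2 i)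
      * Real.exp (z * Kf N N i x.1)

/-- The deformed (maximally superintegrable) Smorodinsky–Winternitz Hamiltonian
`H_z^{MS,SW} = ½ J_+ e^{zJ_-} + ω (sinh(zJ_-)/z) e^{zJ_-}`. -/
noncomputable def Hmssw (N : ℕ) (z ω : ℝ) (b : Fin N → ℝ) : Phase N → ℝ := fun x =>
  1 / 2 * Jpz N z b x * Real.exp (z * Jmz N x)
    + ω * (Real.sinh (z * Jmz N x) / z) * Real.exp (z * Jmz N x)

/-- The additional integral
`I_z = (sinh(zq₁²)/(2zq₁²)) e^{zq₁²} p₁² + (z b₁/(2 sinh(zq₁²))) e^{zq₁²}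
 + (ω/(2z)) e^{2zq₁²}` (here `q₁`, `p₁`, `b₁` refer to the first site). -/
noncomputable def Izsw (N : ℕ) (hN : 0 < N) (z ω : ℝ) (b : Fin N → ℝ) :
    Phase N → ℝ := fun x =>
  Real.sinh (z * (x.1 ⟨0, hN⟩) ^ 2) / (2 * z * (x.1 ⟨0, hN⟩) ^ 2)
      * Real.exp (z * (x.1 ⟨0, hN⟩) ^ 2) * (x.2 ⟨0, hN⟩) ^ 2
    + z * b ⟨0, hN⟩ / (2 * Real.sinh (z * (x.1 ⟨0, hN⟩) ^ 2))
      * Real.exp (z * (x.1 ⟨0, hN⟩) ^ 2)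
    + ω / (2 * z) * Real.exp (2 * z * (x.1 ⟨0, hN⟩) ^ 2)

/-- If `f` depends only on the canonical pair at site `j`, and along the fibre through `x` in which
only that pair varies `g` is an affine function of `f`, then `{f, g}` vanishes at `x`. -/
theorem pb_eq_zero_of_affine_on_site {N : ℕ} {f g : Phase N → ℝ} {x : Phase N} (j : Fin N)
    (a c : ℝ) (hf : ∀ u v : Phase N, u.1 j = v.1 j → u.2 j = v.2 j → f u = f v)
    (hg : ∀ y : Phase N, (∀ i, i ≠ j → y.1 i = x.1 i ∧ y.2 i = x.2 i) → g y = a * f y + c) :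
    pb f g x = 0 := by
  by_cases hdf : DifferentiableAt ℝ f x
  swap
  · simp [pb, fderiv_zero_of_not_differentiableAt hdf]
  by_cases hdg : DifferentiableAt ℝ g x
  swap
  · simp [pb, fderiv_zero_of_not_differentiableAt hdg]
  have off_site (v : Phase N) (h₁ : v.1 j = 0) (h₂ : v.2 j = 0) : fderiv ℝ f x v = 0 := by
    rw [← hdf.lineDeriv_eq_fderiv, lineDeriv]
    have hconst : (fun t : ℝ => f (x + t • v)) = fun _ => f x :=
      funext fun t => hf _ _ (by simp [h₁]) (by simp [h₂])
    rw [hconst, deriv_const]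
  have on_site (v : Phase N) (hv : ∀ i, i ≠ j → v.1 i = 0 ∧ v.2 i = 0) :
      fderiv ℝ g x v = a * fderiv ℝ f x v := by
    rw [← hdf.lineDeriv_eq_fderiv, ← hdg.lineDeriv_eq_fderiv, lineDeriv, lineDeriv]
    have haffine : (fun t : ℝ => g (x + t • v)) = fun t => a * f (x + t • v) + c :=
      funext fun t => hg _ fun i hi => by simp [hv i hi]
    rw [haffine, deriv_add_const, deriv_const_mul_field]
  refine Finset.sum_eq_zero fun i _ => ?_
  by_cases hi : i = j
  · subst hi
    rw [on_site (Pi.single i 1, 0) fun k hk => by simp [hk],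
      on_site (0, Pi.single i 1) fun k hk => by simp [hk]]
    ring
  · rw [off_site (Pi.single i 1, 0) (by simp [Ne.symm hi]) rfl,
      off_site (0, Pi.single i 1) rfl (by simp [Ne.symm hi])]
    ring

theorem Jmz_eq_sq_add_Kf_zero {N : ℕ} (hN : 0 < N) (x : Phase N) :
    Jmz N x = x.1 ⟨0, hN⟩ ^ 2 + Kf N N ⟨0, hN⟩ x.1 := by
  rw [Jmz, Kf, ← Finset.add_sum_erase _ _ (Finset.mem_univ (⟨0, hN⟩ : Fin N)),
    ← Finset.add_sum_erase Finset.univ (fun k : Fin N => ite _ _ _)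
      (Finset.mem_univ (⟨0, hN⟩ : Fin N))]
  simp only [lt_irrefl, false_and, if_false, zero_add]
  congr 1
  refine Finset.sum_congr rfl fun k hk => ?_
  have hk0 : 0 < (k : ℕ) := by
    have := Finset.ne_of_mem_erase hk
    simp only [ne_eq, Fin.ext_iff] at this
    omega
  simp [hk0]

theorem Kf_zero_congr {N : ℕ} (hN : 0 < N) {q q' : Fin N → ℝ}
    (h : ∀ i, i ≠ ⟨0, hN⟩ → q i = q' i) : Kf N N ⟨0, hN⟩ q = Kf N N ⟨0, hN⟩ q' := by
  refine Finset.sum_congr rfl fun k _ => ?_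
  by_cases hk : k = ⟨0, hN⟩
  · simp [hk]
  · rw [h k hk]

/-- For a site `i` other than the first, `K_i + J_-` does not involve `q₁`. -/
theorem Kf_add_Jmz_congr {N : ℕ} (hN : 0 < N) {x y : Phase N}
    (h : ∀ i, i ≠ ⟨0, hN⟩ → y.1 i = x.1 i) {i : Fin N} (hi : i ≠ ⟨0, hN⟩) :
    Kf N N i y.1 + Jmz N y = Kf N N i x.1 + Jmz N x := by
  have hi0 : 0 < (i : ℕ) := by
    simp only [ne_eq, Fin.ext_iff] at hi
    omega
  simp only [Kf, Jmz, ← Finset.sum_add_distrib]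
  refine Finset.sum_congr rfl fun k _ => ?_
  by_cases hk : k = ⟨0, hN⟩
  · simp [hk, hi0]
  · rw [h k hk]

/-- The Hamiltonian is `e^{2zK₁} I_z` plus a remainder not involving the first canonical pair. -/
theorem Hmssw_eq_exp_mul_Izsw_add {N : ℕ} (hN : 0 < N) (z ω : ℝ) (b : Fin N → ℝ) (x : Phase N) :
    Hmssw N z ω b x = exp (2 * z * Kf N N ⟨0, hN⟩ x.1) * Izsw N hN z ω b x
      + (1 / 2 * ∑ i ∈ Finset.univ.erase (⟨0, hN⟩ : Fin N),
          (sinh (z * x.1 i ^ 2) / (z * x.1 i ^ 2) * x.2 i ^ 2 + z * b i / sinh (z * x.1 i ^ 2))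
            * exp (z * (Kf N N i x.1 + Jmz N x)) - ω / (2 * z)) := by
  simp only [mul_add z (Kf N N _ x.1) (Jmz N x), exp_add, ← mul_assoc (_ + _ : ℝ) (exp _) (exp _),
    ← Finset.sum_mul]
  rw [Hmssw, Jpz, ← Finset.add_sum_erase _ _ (Finset.mem_univ (⟨0, hN⟩ : Fin N)), Izsw,
    sinh_eq (z * Jmz N x)]
  have hcancel : exp (-(z * Jmz N x)) * exp (z * Jmz N x) = 1 := by
    rw [← exp_add, neg_add_cancel, exp_zero]
  have hJ : exp (z * Jmz N x) = exp (z * x.1 ⟨0, hN⟩ ^ 2) * exp (z * Kf N N ⟨0, hN⟩ x.1) := by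
    rw [← exp_add, Jmz_eq_sq_add_Kf_zero hN, mul_add]
  have hdouble (w : ℝ) : exp (2 * z * w) = exp (z * w) ^ 2 := by
    rw [← exp_nat_mul]
    push_cast
    ring_nf
  rw [hdouble, hdouble]
  generalize exp (-(z * Jmz N x)) = F at *
  rw [hJ] at *
  generalize exp (z * x.1 ⟨0, hN⟩ ^ 2) = E at *
  generalize exp (z * Kf N N ⟨0, hN⟩ x.1) = G at *
  simp only [div_eq_mul_inv, mul_inv]
  linear_combination (-(ω * z⁻¹ / 2)) * hcancel

/-- `{I_z, H_z^{MS,SW}} = 0` on the open set where every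
`q_i ≠ 0`. -/
theorem Izsw_commutes_with_Hmssw (N : ℕ) (hN : 2 ≤ N) (z ω : ℝ) (hz : z ≠ 0)
    (b : Fin N → ℝ) (x : Phase N) (hx : ∀ i, x.1 i ≠ 0) :
    pb (Izsw N (by omega) z ω b) (Hmssw N z ω b) x = 0 := by
  have hN0 : 0 < N := by omega
  refine pb_eq_zero_of_affine_on_site ⟨0, hN0⟩ (exp (2 * z * Kf N N ⟨0, hN0⟩ x.1))
    (1 / 2 * ∑ i ∈ Finset.univ.erase (⟨0, hN0⟩ : Fin N),
      (sinh (z * x.1 i ^ 2) / (z * x.1 i ^ 2) * x.2 i ^ 2 + z * b i / sinh (z * x.1 i ^ 2))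
        * exp (z * (Kf N N i x.1 + Jmz N x)) - ω / (2 * z)) ?_ ?_
  · intro u v hq hp
    simp only [Izsw, hq, hp]
  · intro y hy
    have hq (i : Fin N) (hi : i ≠ ⟨0, hN0⟩) : y.1 i = x.1 i := (hy i hi).1
    rw [Hmssw_eq_exp_mul_Izsw_add hN0, Kf_zero_congr hN0 hq]
    congr 3
    refine Finset.sum_congr rfl fun i hi => ?_
    have hi' := Finset.ne_of_mem_erase hi
    rw [Kf_add_Jmz_congr hN0 hq hi', (hy i hi').1, (hy i hi').2]
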